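/- Local SGD drift bound under heterogeneity (Lemma B.4). In the local SGD model with τ steps, step size η and initial point x⁰, let additionally f : E → ℝ be differentiable with ‖∇F(a) − ∇f(a)‖ ≤ ε for all a ∈ E. If S > 0, τ ≥ 1 and 0 ≤ η ≤ 1/(√8·S·τ), then ∑_{i=0}^{τ−1} 𝔼[‖X_i − x⁰‖²] ≤ 16τ³η²·(σ² + ε² + ‖∇f(x⁰)‖²). -/

import Mathlib

open MeasureTheory
open scoped RealInnerProductSpace

/-- Fubini for a product of copies of `ν` over `Fin (m + 1)`, splitting off the first coordinate. -/
theorem integrable_pi_fin_cons {Z : Type*} [MeasurableSpace Z] (ν : Measure Z)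
    [IsProbabilityMeasure ν] {m : ℕ} {φ : (Fin (m + 1) → Z) → ℝ}
    (hφ : Integrable φ (Measure.pi fun _ => ν)) :
    (∀ᵐ z ∂ν, Integrable (fun w : Fin m → Z => φ (Fin.cons z w)) (Measure.pi fun _ => ν)) ∧
    Integrable (fun z => ∫ w : Fin m → Z, φ (Fin.cons z w) ∂(Measure.pi fun _ => ν)) ν ∧
    ∫ ω, φ ω ∂(Measure.pi fun _ => ν) =
      ∫ z, ∫ w : Fin m → Z, φ (Fin.cons z w) ∂(Measure.pi fun _ => ν) ∂ν := by
  have hmp := (measurePreserving_piFinSuccAbove (fun _ : Fin (m + 1) => ν) 0).symm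
  have hcons : ∀ p : Z × (Fin m → Z),
      (MeasurableEquiv.piFinSuccAbove (fun _ : Fin (m + 1) => Z) 0).symm p
        = Fin.cons p.1 p.2 := by
    intro p
    simp [MeasurableEquiv.piFinSuccAbove, Fin.insertNthEquiv]
  have hint : Integrable (fun p : Z × (Fin m → Z) => φ (Fin.cons p.1 p.2))
      (ν.prod (Measure.pi fun _ => ν)) := by
    have h := (hmp.integrable_comp_emb (MeasurableEquiv.measurableEmbedding _)).2 hφ
    refine h.congr (Filter.Eventually.of_forall fun p => ?_)
    simp only [Function.comp_apply, hcons]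
  refine ⟨hint.prod_right_ae, hint.integral_prod_left, ?_⟩
  rw [← hmp.integral_comp (MeasurableEquiv.measurableEmbedding _)]
  simp only [hcons]
  exact integral_prod _ hint

/-- The displacement after one step is at most an expansion of the previous one plus noise. -/
theorem sq_le_of_le_add_step {t η S u d n e p γ : ℝ} (ht : 1 ≤ t)
    (hsmall : 8 * η ^ 2 * S ^ 2 * t ^ 2 ≤ 1) (hu : 0 ≤ u) (hγ0 : 0 ≤ γ)
    (hγ : γ ≤ n + S * d + e + p) (hud : u ≤ d + η * γ) :
    u ^ 2 ≤ (1 + 2 / t) * d ^ 2 + 8 * t * η ^ 2 * (n ^ 2 + e ^ 2 + p ^ 2) := by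
  have ht0 : 0 < t := by linarith
  have h1 : u ^ 2 ≤ (d + η * γ) ^ 2 := pow_le_pow_left₀ hu hud 2
  have h2 : γ ^ 2 ≤ (n + S * d + e + p) ^ 2 := pow_le_pow_left₀ hγ0 hγ 2
  have h3 : γ ^ 2 ≤ 4 * (n ^ 2 + S ^ 2 * d ^ 2 + e ^ 2 + p ^ 2) := by
    nlinarith [sq_nonneg (n - S * d), sq_nonneg (n - e), sq_nonneg (n - p),
      sq_nonneg (S * d - e), sq_nonneg (S * d - p), sq_nonneg (e - p)]
  have h4 : t * (d + η * γ) ^ 2 ≤ (t + 1) * d ^ 2 + t * (1 + t) * η ^ 2 * γ ^ 2 := by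
    nlinarith [sq_nonneg (d - t * (η * γ))]
  have h5 : t * (1 + t) * η ^ 2 * γ ^ 2
      ≤ 2 * t ^ 2 * η ^ 2 * (4 * (n ^ 2 + S ^ 2 * d ^ 2 + e ^ 2 + p ^ 2)) := by
    have h : t * (1 + t) ≤ 2 * t ^ 2 := by nlinarith
    gcongr
  have h6 := mul_le_mul_of_nonneg_right hsmall (sq_nonneg d)
  have h7 : t * u ^ 2 ≤ t * ((1 + 2 / t) * d ^ 2 + 8 * t * η ^ 2 * (n ^ 2 + e ^ 2 + p ^ 2)) := by
    have h8 : t * ((1 + 2 / t) * d ^ 2 + 8 * t * η ^ 2 * (n ^ 2 + e ^ 2 + p ^ 2))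
        = (t + 2) * d ^ 2 + 8 * t ^ 2 * η ^ 2 * (n ^ 2 + e ^ 2 + p ^ 2) := by
      field_simp
    rw [h8]
    have h9 := mul_le_mul_of_nonneg_left h1 ht0.le
    linarith
  exact le_of_mul_le_mul_left h7 ht0

/-- The previous displacement is controlled by the displacement after one step plus noise. -/
theorem sq_le_of_le_add_step_reverse {η S u d n q γ : ℝ}
    (hsmall : 8 * η ^ 2 * S ^ 2 ≤ 1) (hd : 0 ≤ d) (hγ0 : 0 ≤ γ)
    (hγ : γ ≤ n + S * d + q) (hdu : d ≤ u + η * γ) :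
    d ^ 2 ≤ 8 * u ^ 2 + 24 * η ^ 2 * (n ^ 2 + q ^ 2) := by
  have h1 : d ^ 2 ≤ (u + η * γ) ^ 2 := pow_le_pow_left₀ hd hdu 2
  have h2 : γ ^ 2 ≤ (n + S * d + q) ^ 2 := pow_le_pow_left₀ hγ0 hγ 2
  have h3 : γ ^ 2 ≤ 3 * (n ^ 2 + S ^ 2 * d ^ 2 + q ^ 2) := by
    nlinarith [sq_nonneg (n - S * d), sq_nonneg (n - q), sq_nonneg (S * d - q)]
  have h4 : (u + η * γ) ^ 2 ≤ 2 * u ^ 2 + 2 * (η ^ 2 * γ ^ 2) := by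
    nlinarith [sq_nonneg (u - η * γ)]
  have h5 := mul_le_mul_of_nonneg_left h3 (sq_nonneg η)
  have h6 := mul_le_mul_of_nonneg_right hsmall (sq_nonneg d)
  linarith

/-- If the squared displacement after one step is integrable, so is the squared noise. -/
theorem integrable_noise_of_integrable_step {E : Type*} [NormedAddCommGroup E]
    [InnerProductSpace ℝ E] [MeasurableSpace E] [BorelSpace E]
    {Z : Type*} [MeasurableSpace Z] {ν : Measure Z} [IsProbabilityMeasure ν]
    {h : Z → E} (hh : Measurable h) {η : ℝ} (hη : 0 < η) {a x0 : E} (v : E)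
    (hint : Integrable (fun z => ‖a - η • h z - x0‖ ^ 2) ν) :
    Integrable (fun z => ‖h z - v‖ ^ 2) ν := by
  have hm : Measurable fun z => ‖h z - v‖ ^ 2 :=
    (show Continuous fun e : E => ‖e - v‖ ^ 2 by fun_prop).measurable.comp hh
  refine Integrable.mono' ((hint.const_mul (2 * (η⁻¹) ^ 2)).add
    (integrable_const (2 * (η⁻¹) ^ 2 * ‖a - x0 - η • v‖ ^ 2))) hm.aestronglyMeasurable
    (Filter.Eventually.of_forall fun z => ?_)
  have hid : h z - v = η⁻¹ • ((a - x0 - η • v) - (a - η • h z - x0)) := by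
    rw [show (a - x0 - η • v) - (a - η • h z - x0) = η • (h z - v) by
      rw [smul_sub]; abel, smul_smul, inv_mul_cancel₀ hη.ne', one_smul]
  have hle := norm_sub_le (a - x0 - η • v) (a - η • h z - x0)
  have hle2 := pow_le_pow_left₀ (norm_nonneg _) hle 2
  have hnn : 0 ≤ (η⁻¹) ^ 2 := by positivity
  rw [Real.norm_of_nonneg (by positivity), hid, norm_smul, mul_pow,
    Real.norm_of_nonneg (by positivity)]
  simp only [Pi.add_apply]
  have := mul_le_mul_of_nonneg_left (hle2.trans (add_sq_le (a := ‖a - x0 - η • v‖)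
    (b := ‖a - η • h z - x0‖))) hnn
  linarith

/-- Iterated displacement bounds: if the squared displacement after `k` steps is integrable, then
its expectation bounds, and is bounded by, the squared initial displacement, up to constants. -/
theorem sgd_displacement_bounds {E : Type*} [NormedAddCommGroup E] [InnerProductSpace ℝ E]
    [MeasurableSpace E] [BorelSpace E]
    {Z : Type*} [MeasurableSpace Z] (ν : Measure Z) [IsProbabilityMeasure ν]
    (D : E → E) (S σ e p t η : ℝ) (x0 : E) (ht : 1 ≤ t) (hη : 0 < η)
    (hsmall : 8 * η ^ 2 * S ^ 2 * t ^ 2 ≤ 1)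
    (hlip : ∀ a : E, ‖D a - D x0‖ ≤ S * ‖a - x0‖) (hD0 : ‖D x0‖ ≤ e + p)
    (g : E → Z → E) (hgmeas : ∀ a, Measurable (g a))
    (hvar : ∀ a : E, ∫ z, ‖g a z - D a‖ ^ 2 ∂ν ≤ σ ^ 2) (k : ℕ) :
    ∃ A B : ℝ, 0 ≤ A ∧ ∀ (n : ℕ) (_ : k ≤ n) (a : E) (X : ℕ → (Fin n → Z) → E)
      (_ : ∀ ω, X 0 ω = a)
      (_ : ∀ (i : ℕ) (hi : i < n) (ω : Fin n → Z),
        X (i + 1) ω = X i ω - η • g (X i ω) (ω ⟨i, hi⟩))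
      (_ : Integrable (fun ω => ‖X k ω - x0‖ ^ 2) (Measure.pi fun _ => ν)),
      ‖a - x0‖ ^ 2 ≤ A * ∫ ω, ‖X k ω - x0‖ ^ 2 ∂(Measure.pi fun _ => ν) + B ∧
      ∫ ω, ‖X k ω - x0‖ ^ 2 ∂(Measure.pi fun _ => ν) ≤ (1 + 2 / t) ^ k * ‖a - x0‖ ^ 2 +
        8 * t * η ^ 2 * (σ ^ 2 + e ^ 2 + p ^ 2) * ∑ j ∈ Finset.range k, (1 + 2 / t) ^ j := by
  have ht0 : 0 < t := by linarith
  induction k with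
  | zero =>
    refine ⟨1, 0, zero_le_one, fun n _ a X hX0 _ _ => ?_⟩
    simp [hX0]
  | succ k ih =>
    obtain ⟨A, B, hA, ih⟩ := ih
    refine ⟨8 * A, 8 * B + 24 * η ^ 2 * (σ ^ 2 + (e + p) ^ 2), by positivity,
      fun n hkn a X hX0 hXrec hint => ?_⟩
    obtain ⟨m, rfl⟩ : ∃ m, n = m + 1 := ⟨n - 1, by omega⟩
    obtain ⟨hslice, hmarg, heq⟩ := integrable_pi_fin_cons ν hint
    set ψ : Z → ℝ := fun z =>
      ∫ w : Fin m → Z, ‖X (k + 1) (Fin.cons z w) - x0‖ ^ 2 ∂(Measure.pi fun _ => ν) with hψ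
    set R : ℝ := (1 + 2 / t) ^ k with hR
    set Q : ℝ := 8 * t * η ^ 2 * (σ ^ 2 + e ^ 2 + p ^ 2) *
      ∑ j ∈ Finset.range k, (1 + 2 / t) ^ j with hQ
    have hR0 : 0 ≤ R := by positivity
    have hstep : ∀ᵐ z ∂ν, ‖a - η • g a z - x0‖ ^ 2 ≤ A * ψ z + B ∧
        ψ z ≤ R * ‖a - η • g a z - x0‖ ^ 2 + Q := by
      filter_upwards [hslice] with z hz
      refine ih m (by omega) (a - η • g a z) (fun i w => X (i + 1) (Fin.cons z w)) ?_ ?_ hz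
      · intro w
        have h := hXrec 0 (Nat.succ_pos m) (Fin.cons z w)
        rw [hX0] at h
        simpa using h
      · intro i hi w
        have h := hXrec (i + 1) (Nat.succ_lt_succ hi) (Fin.cons z w)
        rw [h]
        congr 2
    have hu : Integrable (fun z => ‖a - η • g a z - x0‖ ^ 2) ν := by
      refine Integrable.mono' ((hmarg.const_mul A).add (integrable_const B)) ?_ ?_
      · exact ((show Continuous fun y : E => ‖a - η • y - x0‖ ^ 2 by
          fun_prop).measurable.comp (hgmeas a)).aestronglyMeasurable
      · filter_upwards [hstep] with z hz
        rw [Real.norm_of_nonneg (by positivity)]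
        exact hz.1
    have hn := integrable_noise_of_integrable_step (hgmeas a) hη (D a) hu
    have hγ : ∀ z, ‖g a z‖ ≤ ‖g a z - D a‖ + S * ‖a - x0‖ + (e + p) := fun z => by
      have h1 : ‖g a z‖ ≤ ‖g a z - D a‖ + ‖D a - D x0‖ + ‖D x0‖ := by
        simpa using norm_add₃_le (a := g a z - D a) (b := D a - D x0) (c := D x0)
      linarith [hlip a]
    have hsmall1 : 8 * η ^ 2 * S ^ 2 ≤ 1 := by
      refine le_trans (le_mul_of_one_le_right (by positivity) ?_) hsmall
      exact one_le_pow₀ ht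
    have hηg : ∀ z, ‖η • g a z‖ = η * ‖g a z‖ := fun z => by
      rw [norm_smul, Real.norm_of_nonneg hη.le]
    have hψup : ∫ z, ψ z ∂ν ≤ R * ∫ z, ‖a - η • g a z - x0‖ ^ 2 ∂ν + Q := by
      calc ∫ z, ψ z ∂ν ≤ ∫ z, (R * ‖a - η • g a z - x0‖ ^ 2 + Q) ∂ν :=
            integral_mono_ae hmarg ((hu.const_mul R).add (integrable_const Q))
              (hstep.mono fun z hz => hz.2)
        _ = _ := by
            rw [integral_add (hu.const_mul R) (integrable_const Q), integral_const_mul]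
            simp
    have hψlow : ∫ z, ‖a - η • g a z - x0‖ ^ 2 ∂ν ≤ A * ∫ z, ψ z ∂ν + B := by
      calc ∫ z, ‖a - η • g a z - x0‖ ^ 2 ∂ν ≤ ∫ z, (A * ψ z + B) ∂ν :=
            integral_mono_ae hu ((hmarg.const_mul A).add (integrable_const B))
              (hstep.mono fun z hz => hz.1)
        _ = _ := by
            rw [integral_add (hmarg.const_mul A) (integrable_const B), integral_const_mul]
            simp
    have hup : ∫ z, ‖a - η • g a z - x0‖ ^ 2 ∂ν ≤
        (1 + 2 / t) * ‖a - x0‖ ^ 2 + 8 * t * η ^ 2 * (σ ^ 2 + e ^ 2 + p ^ 2) := by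
      have hr : ∀ z, ‖a - η • g a z - x0‖ ^ 2 ≤ 8 * t * η ^ 2 * ‖g a z - D a‖ ^ 2 +
          ((1 + 2 / t) * ‖a - x0‖ ^ 2 + 8 * t * η ^ 2 * (e ^ 2 + p ^ 2)) := fun z => by
        have h := sq_le_of_le_add_step (u := ‖a - η • g a z - x0‖) (d := ‖a - x0‖) ht
          hsmall (norm_nonneg _) (norm_nonneg (g a z))
          (by linarith [hγ z] : ‖g a z‖ ≤ ‖g a z - D a‖ + S * ‖a - x0‖ + e + p) (by
            rw [← hηg z, sub_right_comm]
            exact norm_sub_le _ _)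
        linarith
      have h := integral_mono hu ((hn.const_mul _).add (integrable_const _)) hr
      simp only [Pi.add_apply] at h
      rw [integral_add (hn.const_mul _) (integrable_const _), integral_const_mul] at h
      have hv := mul_le_mul_of_nonneg_left (hvar a) (by positivity : 0 ≤ 8 * t * η ^ 2)
      simp only [integral_const, probReal_univ, one_smul] at h
      linarith
    have hlow : ‖a - x0‖ ^ 2 ≤ 8 * ∫ z, ‖a - η • g a z - x0‖ ^ 2 ∂ν +
        24 * η ^ 2 * (σ ^ 2 + (e + p) ^ 2) := by
      have hr : ∀ z, ‖a - x0‖ ^ 2 ≤ 8 * ‖a - η • g a z - x0‖ ^ 2 +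
          (24 * η ^ 2 * ‖g a z - D a‖ ^ 2 + 24 * η ^ 2 * (e + p) ^ 2) := fun z => by
        have h := sq_le_of_le_add_step_reverse (u := ‖a - η • g a z - x0‖) (d := ‖a - x0‖)
          hsmall1 (norm_nonneg _) (norm_nonneg (g a z)) (hγ z) (by
            rw [← hηg z]
            have h := norm_add_le (a - η • g a z - x0) (η • g a z)
            rwa [show a - η • g a z - x0 + η • g a z = a - x0 by abel] at h)
        linarith
      have hn' : Integrable (fun z => 24 * η ^ 2 * ‖g a z - D a‖ ^ 2 +
          24 * η ^ 2 * (e + p) ^ 2) ν := (hn.const_mul _).add (integrable_const _)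
      have h := integral_mono (integrable_const _) ((hu.const_mul 8).add hn') hr
      simp only [Pi.add_apply] at h
      rw [integral_add (hu.const_mul _) hn', integral_const_mul,
        integral_add (hn.const_mul _) (integrable_const _), integral_const_mul] at h
      have hv := mul_le_mul_of_nonneg_left (hvar a) (by positivity : 0 ≤ 24 * η ^ 2)
      simp only [integral_const, probReal_univ, one_smul] at h
      linarith
    rw [heq]
    refine ⟨?_, ?_⟩
    · linarith
    · rw [Finset.sum_range_succ, pow_succ, ← hR, mul_add (8 * t * _ * _), ← hQ]
      have h := mul_le_mul_of_nonneg_left hup hR0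
      linarith

/-- The double geometric sum with ratio `1 + 2 / τ` is at most quadratic in `τ`. -/
theorem sum_sum_geom_le {τ : ℕ} (hτ : 1 ≤ τ) :
    ∑ k ∈ Finset.range τ, ∑ j ∈ Finset.range k, (1 + 2 / (τ : ℝ)) ^ j ≤ 2 * (τ : ℝ) ^ 2 := by
  have ht0 : (0 : ℝ) < τ := by exact_mod_cast hτ
  have hgeom : ∀ k : ℕ, ∑ j ∈ Finset.range k, (1 + 2 / (τ : ℝ)) ^ j
      = τ / 2 * ((1 + 2 / (τ : ℝ)) ^ k - 1) := fun k => by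
    have h := geom_sum_mul (1 + 2 / (τ : ℝ)) k
    rw [← h]
    field_simp
    ring
  have hexp : (1 + 2 / (τ : ℝ)) ^ τ ≤ 9 := by
    calc (1 + 2 / (τ : ℝ)) ^ τ ≤ Real.exp (2 / τ) ^ τ := by
          refine pow_le_pow_left₀ (by positivity) ?_ _
          linarith [Real.add_one_le_exp (2 / (τ : ℝ))]
      _ = Real.exp 1 ^ 2 := by
          rw [← Real.exp_nat_mul, ← Real.exp_nat_mul]
          congr 1
          push_cast
          field_simp
      _ ≤ 3 ^ 2 := pow_le_pow_left₀ (Real.exp_pos 1).le Real.exp_one_lt_three.le 2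
      _ = 9 := by norm_num
  simp only [hgeom]
  rw [← Finset.mul_sum, Finset.sum_sub_distrib, hgeom]
  simp only [Finset.sum_const, Finset.card_range, nsmul_eq_mul, mul_one]
  nlinarith [mul_le_mul_of_nonneg_left hexp (sq_nonneg (τ : ℝ))]

/-- Local SGD drift bound under heterogeneity (Lemma B.4). -/
theorem stmt_8 {E : Type*} [NormedAddCommGroup E] [InnerProductSpace ℝ E] [CompleteSpace E]
    [MeasurableSpace E] [BorelSpace E]
    {Z : Type*} [MeasurableSpace Z] (ν : Measure Z) [IsProbabilityMeasure ν]
    (F f : E → ℝ) (S σ G ε : ℝ) (hS : 0 < S)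
    (hFdiff : Differentiable ℝ F) (hfdiff : Differentiable ℝ f)
    (hlip : ∀ a b : E, ‖gradient F a - gradient F b‖ ≤ S * ‖a - b‖)
    (hhet : ∀ a : E, ‖gradient F a - gradient f a‖ ≤ ε)
    (g : E → Z → E) (hgmeas : Measurable (Function.uncurry g))
    (hmean : ∀ a : E, ∫ z, g a z ∂ν = gradient F a)
    (hvar : ∀ a : E, ∫ z, ‖g a z - gradient F a‖ ^ 2 ∂ν ≤ σ ^ 2)
    (hsecond : ∀ a : E, ∫ z, ‖g a z‖ ^ 2 ∂ν ≤ G ^ 2)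
    (τ : ℕ) (hτ : 1 ≤ τ) (η : ℝ) (hη0 : 0 ≤ η) (hη : η ≤ 1 / (Real.sqrt 8 * S * τ))
    (x0 : E) (X : ℕ → (Fin τ → Z) → E)
    (hX0 : ∀ ω, X 0 ω = x0)
    (hXrec : ∀ (i : ℕ) (hi : i < τ) (ω : Fin τ → Z),
      X (i + 1) ω = X i ω - η • g (X i ω) (ω ⟨i, hi⟩)) :
    ∑ i ∈ Finset.range τ,
        ∫ ω, ‖X i ω - x0‖ ^ 2 ∂(Measure.pi fun _ : Fin τ => ν) ≤
      16 * (τ : ℝ) ^ 3 * η ^ 2 * (σ ^ 2 + ε ^ 2 + ‖gradient f x0‖ ^ 2) := by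
  have ht : (1 : ℝ) ≤ τ := by exact_mod_cast hτ
  have ht0 : (0 : ℝ) < τ := by linarith
  rcases hη0.eq_or_lt with rfl | hηpos
  · have hconst : ∀ i ≤ τ, ∀ ω, X i ω = x0 := by
      intro i
      induction i with
      | zero => exact fun _ ω => hX0 ω
      | succ i ih =>
        intro hi ω
        rw [hXrec i hi ω, ih (by omega) ω, zero_smul, sub_zero]
    rw [Finset.sum_eq_zero]
    · simp
    · intro i hi
      have hi' := (Finset.mem_range.1 hi).le
      simp [hconst i hi']
  have hsmall : 8 * η ^ 2 * S ^ 2 * (τ : ℝ) ^ 2 ≤ 1 := by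
    have hs : 0 < Real.sqrt 8 := by positivity
    rw [le_div_iff₀ (by positivity)] at hη
    have h := pow_le_pow_left₀ (by positivity) hη 2
    have h8 : Real.sqrt 8 ^ 2 = 8 := Real.sq_sqrt (by norm_num)
    calc 8 * η ^ 2 * S ^ 2 * (τ : ℝ) ^ 2 = (η * (Real.sqrt 8 * S * τ)) ^ 2 := by
          rw [mul_pow, mul_pow, mul_pow, h8]; ring
      _ ≤ 1 := by simpa using h
  have hD0 : ‖gradient F x0‖ ≤ ε + ‖gradient f x0‖ := by
    have h := norm_add_le (gradient F x0 - gradient f x0) (gradient f x0)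
    rw [sub_add_cancel] at h
    linarith [hhet x0]
  have hterm : ∀ i ∈ Finset.range τ,
      ∫ ω, ‖X i ω - x0‖ ^ 2 ∂(Measure.pi fun _ : Fin τ => ν) ≤
        8 * τ * η ^ 2 * (σ ^ 2 + ε ^ 2 + ‖gradient f x0‖ ^ 2) *
          ∑ j ∈ Finset.range i, (1 + 2 / (τ : ℝ)) ^ j := by
    intro i hi
    by_cases hint : Integrable (fun ω => ‖X i ω - x0‖ ^ 2) (Measure.pi fun _ : Fin τ => ν)
    · obtain ⟨A, B, -, h⟩ := sgd_displacement_bounds ν (gradient F) S σ ε ‖gradient f x0‖ τ η x0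
        ht hηpos hsmall (fun a => hlip a x0) hD0 g
        (fun a => hgmeas.comp measurable_prodMk_left) hvar i
      simpa using (h τ (Finset.mem_range.1 hi).le x0 X hX0 hXrec hint).2
    · rw [integral_undef hint]
      positivity
  refine (Finset.sum_le_sum hterm).trans ?_
  rw [← Finset.mul_sum]
  have h := mul_le_mul_of_nonneg_left (sum_sum_geom_le hτ)
    (by positivity : 0 ≤ 8 * τ * η ^ 2 * (σ ^ 2 + ε ^ 2 + ‖gradient f x0‖ ^ 2))
  linarith
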